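/- arXiv:1402.4489 — 3 statements merged into one kernel-verified Lean document; each statement's English description precedes it below -/
import Mathlib

section
/- Let N be a positive integer, let φ : {1,…,N}ⁿ → ℂ, and define T_φ(t) := Σ_{1≤x₁≤t₁} ⋯ Σ_{1≤xₙ≤tₙ} φ(x) for t ∈ ℝⁿ (the sums over integers xᵢ). Then for any g ∈ Cⁿ(ℝⁿ) one has the identity Σ_{1≤x≤N} g(x)φ(x) = Σ_{ε∈{0,1}ⁿ} ((−N)^{ε₁+⋯+εₙ}/Nⁿ) ∫_{[0,N]ⁿ} ∂^ε g(N·ε̄ + t_ε) · T_φ(N·ε̄ + t_ε) dt, where ε̄ := (1,…,1) − ε and t_ε denotes the vector whose i-th coordinate equals 0 if εᵢ = 0 and equals tᵢ if εᵢ = 1. -/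
noncomputable section
open MeasureTheory

/-- Mixed partial derivative `∂^ε g` for `g : ℝⁿ → ℂ`. -/
def mpderivC (n : ℕ) (ε : Fin n → ℕ) (g : (Fin n → ℝ) → ℂ) : (Fin n → ℝ) → ℂ :=
  (List.finRange n).foldr
    (fun i h => (fun u : (Fin n → ℝ) → ℂ => fun x => fderiv ℝ u x (Pi.single i 1))^[ε i] h) g

/-- `T_φ(t) = Σ_{1 ≤ x₁ ≤ t₁} ⋯ Σ_{1 ≤ xₙ ≤ tₙ} φ(x)`. -/
def Tsum (n : ℕ) (φ : (Fin n → ℤ) → ℂ) (t : Fin n → ℝ) : ℂ :=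
  ∑ x ∈ Finset.Icc (1 : Fin n → ℤ) (fun i => ⌊t i⌋), φ x

/-- Iterated partial derivatives along a list of coordinates, the head of the list outermost. -/
def partialsAlong {n : ℕ} (l : List (Fin n)) (ε : Fin n → ℕ) (g : (Fin n → ℝ) → ℂ) :
    (Fin n → ℝ) → ℂ :=
  l.foldr
    (fun i h => (fun u : (Fin n → ℝ) → ℂ => fun x => fderiv ℝ u x (Pi.single i 1))^[ε i] h) g

/-- The point with coordinate `N` where `ε` vanishes and coordinate `t i` where `ε i = 1`. -/
def mixedPoint {n : ℕ} (N : ℕ) (ε : Fin n → ℕ) (t : Fin n → ℝ) : Fin n → ℝ :=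
  fun i => (N : ℝ) * (1 - (ε i : ℝ)) + if ε i = 0 then 0 else t i

/-- The indicator of `a i ≤ t i` for all `i` with `ε i ≠ 0`. -/
def upperWeight {n : ℕ} (a : Fin n → ℝ) (ε : Fin n → ℕ) (t : Fin n → ℝ) : ℂ :=
  ∏ i, if ε i = 0 then 1 else if a i ≤ t i then 1 else 0

lemma partialsAlong_cons_zero {n : ℕ} {i : Fin n} {l : List (Fin n)} {ε : Fin n → ℕ}
    (h : ε i = 0) (g : (Fin n → ℝ) → ℂ) :
    partialsAlong (i :: l) ε g = partialsAlong l ε g := by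
  simp [partialsAlong, h]

lemma partialsAlong_cons_one {n : ℕ} {i : Fin n} {l : List (Fin n)} {ε : Fin n → ℕ}
    (h : ε i = 1) (g : (Fin n → ℝ) → ℂ) :
    partialsAlong (i :: l) ε g =
      fun x => fderiv ℝ (partialsAlong l ε g) x (Pi.single i 1) := by
  simp [partialsAlong, h]

lemma contDiff_partialsAlong {n : ℕ} {ε : Fin n → ℕ} (hε : ∀ i, ε i ≤ 1)
    {g : (Fin n → ℝ) → ℂ} (l : List (Fin n)) (k : ℕ)
    (hg : ContDiff ℝ ((k + l.length : ℕ) : ℕ∞) g) :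
    ContDiff ℝ (k : ℕ∞) (partialsAlong l ε g) := by
  induction l generalizing k with
  | nil => simpa [partialsAlong] using hg
  | cons i l ih =>
    have h1 : ContDiff ℝ ((k + 1 : ℕ) : ℕ∞) (partialsAlong l ε g) := by
      apply ih
      convert hg using 3
      simp only [List.length_cons]
      omega
    rcases Nat.le_one_iff_eq_zero_or_eq_one.mp (hε i) with h | h
    · rw [partialsAlong_cons_zero h]
      exact h1.of_le (by exact_mod_cast Nat.le_succ k)
    · rw [partialsAlong_cons_one h]
      exact (h1.fderiv_right (by norm_cast)).clm_apply contDiff_const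

lemma hasFDerivAt_cons_right {n : ℕ} (c : ℝ) (y : Fin n → ℝ) :
    HasFDerivAt (fun z : Fin n → ℝ => (Fin.cons c z : Fin (n + 1) → ℝ))
      (ContinuousLinearMap.pi
        (Fin.cons 0 fun i => ContinuousLinearMap.proj i : Fin (n + 1) → (Fin n → ℝ) →L[ℝ] ℝ)) y := by
  rw [hasFDerivAt_pi]
  intro i
  refine Fin.cases ?_ (fun j => ?_) i
  · simpa using hasFDerivAt_const c y
  · simpa using hasFDerivAt_apply j y

lemma contDiff_cons_right {n : ℕ} (c : ℝ) {k : WithTop ℕ∞} :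
    ContDiff ℝ k (fun z : Fin n → ℝ => (Fin.cons c z : Fin (n + 1) → ℝ)) := by
  rw [contDiff_pi]
  intro i
  refine Fin.cases ?_ (fun j => ?_) i
  · simpa using contDiff_const
  · simpa using contDiff_apply ℝ ℝ j

lemma hasDerivAt_cons_left {n : ℕ} (c : ℝ) (y : Fin n → ℝ) :
    HasDerivAt (fun s : ℝ => (Fin.cons s y : Fin (n + 1) → ℝ)) (Pi.single 0 1) c := by
  rw [hasDerivAt_pi]
  intro i
  refine Fin.cases ?_ (fun j => ?_) i
  · simpa using hasDerivAt_id' c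
  · simpa [Pi.single_apply] using hasDerivAt_const c (y j)

lemma fderiv_slice {n : ℕ} {u : (Fin (n + 1) → ℝ) → ℂ} (c : ℝ) (y : Fin n → ℝ)
    (hu : DifferentiableAt ℝ u (Fin.cons c y)) (i : Fin n) :
    fderiv ℝ (fun z : Fin n → ℝ => u (Fin.cons c z)) y (Pi.single i 1) =
      fderiv ℝ u (Fin.cons c y) (Pi.single i.succ 1) := by
  have h := hu.hasFDerivAt.comp y (hasFDerivAt_cons_right c y)
  rw [show (fun z : Fin n → ℝ => u (Fin.cons c z)) =
    u ∘ fun z : Fin n → ℝ => (Fin.cons c z : Fin (n + 1) → ℝ) from rfl, h.fderiv,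
    ContinuousLinearMap.comp_apply]
  congr 1
  ext j
  refine Fin.cases ?_ (fun k => ?_) j
  · simp
  · simp [Pi.single_apply]

lemma partialsAlong_slice {n : ℕ} {ε : Fin n → ℕ} (hε : ∀ i, ε i ≤ 1) (e : ℕ) (he : e ≤ 1)
    {g : (Fin (n + 1) → ℝ) → ℂ} (l : List (Fin n)) (hg : ContDiff ℝ (l.length : ℕ∞) g)
    (c : ℝ) :
    partialsAlong l ε (fun z => g (Fin.cons c z)) =
      fun y => partialsAlong (l.map Fin.succ) (Fin.cons e ε) g (Fin.cons c y) := by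
  have hε' : ∀ i, (Fin.cons e ε : Fin (n + 1) → ℕ) i ≤ 1 :=
    Fin.cases (by simpa using he) (by simpa using hε)
  induction l with
  | nil => rfl
  | cons i l ih =>
    have ih' := ih (hg.of_le (by simp))
    rw [List.map_cons]
    rcases Nat.le_one_iff_eq_zero_or_eq_one.mp (hε i) with h | h
    · rw [partialsAlong_cons_zero h, partialsAlong_cons_zero (by simpa using h), ih']
    · rw [partialsAlong_cons_one h, partialsAlong_cons_one (by simpa using h), ih']
      funext y
      apply fderiv_slice
      have h1 : ContDiff ℝ ((1 : ℕ) : ℕ∞)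
          (partialsAlong (l.map Fin.succ) (Fin.cons e ε) g) := by
        apply contDiff_partialsAlong hε'
        convert hg using 3
        simp [add_comm]
      exact h1.differentiable (by simp) _

lemma partialsAlong_congr {n : ℕ} {ε ε' : Fin n → ℕ} (l : List (Fin n))
    (h : ∀ i ∈ l, ε i = ε' i) (g : (Fin n → ℝ) → ℂ) :
    partialsAlong l ε g = partialsAlong l ε' g := by
  induction l with
  | nil => rfl
  | cons i l ih =>
    have := ih fun j hj => h j (List.mem_cons_of_mem _ hj)
    simp only [partialsAlong, List.foldr_cons] at this ⊢
    rw [this, h i List.mem_cons_self]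

lemma continuous_mpderivC {n : ℕ} {ε : Fin n → ℕ} (hε : ∀ i, ε i ≤ 1)
    {g : (Fin n → ℝ) → ℂ} (hg : ContDiff ℝ (n : ℕ∞) g) : Continuous (mpderivC n ε g) :=
  (contDiff_partialsAlong hε (List.finRange n) 0 (by simpa using hg)).continuous

lemma continuous_mixedPoint {n : ℕ} (N : ℕ) (ε : Fin n → ℕ) :
    Continuous (mixedPoint N ε) := by
  refine continuous_pi fun i => ?_
  unfold mixedPoint
  split_ifs <;> fun_prop

lemma measurable_upperWeight {n : ℕ} (a : Fin n → ℝ) (ε : Fin n → ℕ) :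
    Measurable (upperWeight a ε) := by
  unfold upperWeight
  refine Finset.measurable_prod _ fun i _ => ?_
  split_ifs
  · exact measurable_const
  · exact Measurable.ite (measurableSet_le measurable_const (measurable_pi_apply i))
      measurable_const measurable_const

lemma norm_upperWeight_le {n : ℕ} (a : Fin n → ℝ) (ε : Fin n → ℕ) (t : Fin n → ℝ) :
    ‖upperWeight a ε t‖ ≤ 1 := by
  rw [upperWeight, norm_prod]
  refine Finset.prod_le_one (fun i _ => norm_nonneg _) fun i _ => ?_
  split_ifs <;> simp

lemma integrableOn_mul_upperWeight {n : ℕ} (N : ℕ) (a : Fin n → ℝ) (ε : Fin n → ℕ)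
    {F : (Fin n → ℝ) → ℂ} (hF : Continuous F) :
    IntegrableOn (fun t => F (mixedPoint N ε t) * upperWeight a ε t)
      (Set.Icc (0 : Fin n → ℝ) (fun _ => (N : ℝ))) := by
  refine Integrable.mul_bdd (c := 1) ?_ (measurable_upperWeight a ε).aestronglyMeasurable
    (ae_of_all _ (norm_upperWeight_le a ε))
  exact (hF.comp (continuous_mixedPoint N ε)).continuousOn.integrableOn_compact isCompact_Icc

lemma setIntegral_Icc_succ {n : ℕ} (N : ℕ) {G : (Fin (n + 1) → ℝ) → ℂ}
    (hG : IntegrableOn G (Set.Icc (0 : Fin (n + 1) → ℝ) (fun _ => (N : ℝ)))) :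
    ∫ t in Set.Icc (0 : Fin (n + 1) → ℝ) (fun _ => (N : ℝ)), G t =
      ∫ y in Set.Icc (0 : Fin n → ℝ) (fun _ => (N : ℝ)),
        ∫ s in Set.Icc (0 : ℝ) N, G (Fin.cons s y) := by
  set e := (MeasurableEquiv.piFinSuccAbove (fun _ : Fin (n + 1) => ℝ) 0).symm
  have he : MeasurePreserving e :=
    (volume_preserving_piFinSuccAbove (fun _ : Fin (n + 1) => ℝ) 0).symm _
  have hcons : ∀ p : ℝ × (Fin n → ℝ), e p = Fin.cons p.1 p.2 := by
    intro p
    simp [e, MeasurableEquiv.piFinSuccAbove_symm_apply, Fin.insertNthEquiv]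
  have hpre : e ⁻¹' Set.Icc (0 : Fin (n + 1) → ℝ) (fun _ => (N : ℝ)) =
      Set.Icc (0 : ℝ) N ×ˢ Set.Icc (0 : Fin n → ℝ) (fun _ => (N : ℝ)) := by
    ext p
    simp only [Set.mem_preimage, hcons, Set.mem_Icc, Set.mem_prod, Pi.le_def, Fin.forall_fin_succ,
      Fin.cons_zero, Fin.cons_succ, Pi.zero_apply]
    tauto
  have hG' := (he.integrableOn_comp_preimage e.measurableEmbedding).mpr hG
  rw [hpre, IntegrableOn, Measure.volume_eq_prod, ← Measure.prod_restrict] at hG'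
  rw [← he.setIntegral_preimage_emb e.measurableEmbedding, hpre, Measure.volume_eq_prod,
    ← Measure.prod_restrict, integral_prod_symm (fun p => G (e p)) hG']
  simp only [hcons]

lemma mixedPoint_cons {n : ℕ} (N e : ℕ) (ε : Fin n → ℕ) (s : ℝ) (y : Fin n → ℝ) :
    mixedPoint N (Fin.cons e ε : Fin (n + 1) → ℕ) (Fin.cons s y) =
      Fin.cons ((N : ℝ) * (1 - (e : ℝ)) + if e = 0 then 0 else s) (mixedPoint N ε y) := by
  funext i
  refine Fin.cases ?_ (fun j => ?_) i <;> simp [mixedPoint]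

lemma upperWeight_cons {n : ℕ} (a : Fin (n + 1) → ℝ) (e : ℕ) (ε : Fin n → ℕ) (s : ℝ)
    (y : Fin n → ℝ) :
    upperWeight a (Fin.cons e ε : Fin (n + 1) → ℕ) (Fin.cons s y) =
      (if e = 0 then 1 else if a 0 ≤ s then 1 else 0) * upperWeight (Fin.tail a) ε y := by
  rw [upperWeight, Fin.prod_univ_succ]
  rfl

lemma setIntegral_deriv_mul_indicator {h h' : ℝ → ℂ} (hh : ∀ s, HasDerivAt h (h' s) s)
    (hc : Continuous h') {a N : ℝ} (ha : 0 ≤ a) (haN : a ≤ N) :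
    ∫ s in Set.Icc 0 N, h' s * (if a ≤ s then 1 else 0) = h N - h a := by
  have h1 : (fun s => h' s * (if a ≤ s then 1 else 0)) = (Set.Ici a).indicator h' := by
    funext s
    simp [Set.indicator_apply]
  rw [h1, setIntegral_indicator measurableSet_Ici]
  have h2 : Set.Icc 0 N ∩ Set.Ici a = Set.Icc a N := by
    ext s
    simp only [Set.mem_inter_iff, Set.mem_Icc, Set.mem_Ici]
    constructor
    · rintro ⟨⟨_, h⟩, h'⟩
      exact ⟨h', h⟩
    · rintro ⟨h, h'⟩
      exact ⟨⟨ha.trans h, h'⟩, h⟩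
  rw [h2, integral_Icc_eq_integral_Ioc, ← intervalIntegral.integral_of_le haN]
  exact intervalIntegral.integral_eq_sub_of_hasDerivAt (fun s _ => hh s)
    (hc.intervalIntegrable _ _)

lemma sum_Icc_zero_one_succ {n : ℕ} (f : (Fin (n + 1) → ℕ) → ℂ) :
    ∑ ε ∈ Finset.Icc (0 : Fin (n + 1) → ℕ) (fun _ => 1), f ε =
      ∑ ε ∈ Finset.Icc (0 : Fin n → ℕ) (fun _ => 1),
        (f (Fin.cons 0 ε) + f (Fin.cons 1 ε)) := by
  have h01 : Finset.Icc 0 1 = ({0, 1} : Finset ℕ) := by decide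
  have key : ∑ ε ∈ Finset.Icc (0 : Fin (n + 1) → ℕ) (fun _ => 1), f ε =
      ∑ p ∈ Finset.Icc (0 : ℕ) 1 ×ˢ Finset.Icc (0 : Fin n → ℕ) (fun _ => 1),
        f (Fin.cons p.1 p.2) := by
    refine Finset.sum_nbij' (fun ε => (ε 0, Fin.tail ε)) (fun p => Fin.cons p.1 p.2)
      ?_ ?_ ?_ ?_ ?_
    · intro ε
      simp only [Finset.mem_Icc, Finset.mem_product, Pi.le_def, Fin.tail]
      rintro ⟨h1, h2⟩
      exact ⟨⟨h1 0, h2 0⟩, fun i => h1 _, fun i => h2 _⟩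
    · intro p
      simp only [Finset.mem_Icc, Finset.mem_product, Pi.le_def, Fin.forall_fin_succ, Fin.cons_zero,
        Fin.cons_succ, Pi.zero_apply]
      tauto
    · intro ε _
      simp
    · intro p _
      simp
    · intro ε _
      simp
  rw [key, Finset.sum_product, h01, Finset.sum_pair (by norm_num), ← Finset.sum_add_distrib]

lemma mpderivC_cons_eq {n : ℕ} {ε : Fin n → ℕ} (e : ℕ) (g : (Fin (n + 1) → ℝ) → ℂ) :
    mpderivC (n + 1) (Fin.cons e ε) g =
      partialsAlong (0 :: (List.finRange n).map Fin.succ) (Fin.cons e ε) g := by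
  rw [← List.finRange_succ]
  rfl

/-- The value of `g` at a point of the cube, as a sum of integrals of its mixed derivatives. -/
lemma eq_sum_integral_mpderivC (n N : ℕ) (hN : 0 < N) (g : (Fin n → ℝ) → ℂ)
    (hg : ContDiff ℝ (n : ℕ∞) g) (a : Fin n → ℝ) (ha : ∀ i, 0 ≤ a i) (haN : ∀ i, a i ≤ N) :
    g a = ∑ ε ∈ Finset.Icc (0 : Fin n → ℕ) (fun _ => 1),
        ((-(N : ℂ)) ^ (∑ i, ε i) / (N : ℂ) ^ n) *
          ∫ t in Set.Icc (0 : Fin n → ℝ) (fun _ => (N : ℝ)),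
            mpderivC n ε g (mixedPoint N ε t) * upperWeight a ε t := by
  have hN0 : (N : ℂ) ≠ 0 := by exact_mod_cast hN.ne'
  induction n with
  | zero =>
    have hI : Finset.Icc (0 : Fin 0 → ℕ) (fun _ => 1) = {0} := by
      ext ε
      simp [Subsingleton.elim ε 0]
    have hS : Set.Icc (0 : Fin 0 → ℝ) (fun _ => (N : ℝ)) = Set.univ := by
      ext t
      simp
    have hgc : ∀ t, mpderivC 0 0 g (mixedPoint N 0 t) = g a := fun t => by
      rw [Subsingleton.elim (mixedPoint N 0 t) a]
      rfl
    rw [hI, hS, Finset.sum_singleton]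
    simp only [hgc, upperWeight, Finset.univ_eq_empty, Finset.prod_empty]
    simp [volume_pi, Measure.pi_of_empty (x := a)]
  | succ n ih =>
    have hslice : ContDiff ℝ (n : ℕ∞) fun z : Fin n → ℝ => g (Fin.cons (a 0) z) :=
      (hg.of_le (by simp)).comp (contDiff_cons_right (a 0))
    have h0 := ih (fun z => g (Fin.cons (a 0) z)) hslice (Fin.tail a) (fun i => ha _)
      (fun i => haN _)
    rw [sum_Icc_zero_one_succ]
    simp only [Fin.cons_self_tail] at h0
    rw [h0]
    refine Finset.sum_congr rfl fun ε hε => ?_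
    have hε1 : ∀ i, ε i ≤ 1 := fun i => (Finset.mem_Icc.mp hε).2 i
    have hcons : ∀ e ≤ 1, ∀ i, (Fin.cons e ε : Fin (n + 1) → ℕ) i ≤ 1 := fun e he =>
      Fin.cases (by simpa using he) (by simpa using hε1)
    set H := partialsAlong ((List.finRange n).map Fin.succ) (Fin.cons 0 ε) g
    have hH1 : partialsAlong ((List.finRange n).map Fin.succ) (Fin.cons 1 ε) g = H := by
      refine partialsAlong_congr _ (fun i hi => ?_) g
      obtain ⟨j, -, rfl⟩ := List.mem_map.mp hi
      rfl
    have hHc : ContDiff ℝ ((1 : ℕ) : ℕ∞) H := by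
      apply contDiff_partialsAlong (hcons 0 zero_le_one)
      convert hg using 3
      simp [add_comm]
    have hm : mpderivC n ε (fun z => g (Fin.cons (a 0) z)) = fun y => H (Fin.cons (a 0) y) :=
      partialsAlong_slice hε1 0 zero_le_one _ (by simpa using hg.of_le (by simp)) (a 0)
    have hD0 : mpderivC (n + 1) (Fin.cons 0 ε) g = H := by
      rw [mpderivC_cons_eq, partialsAlong_cons_zero (by simp)]
    have hD1 : mpderivC (n + 1) (Fin.cons 1 ε) g = fun x => fderiv ℝ H x (Pi.single 0 1) := by
      rw [mpderivC_cons_eq, partialsAlong_cons_one (by simp), hH1]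
    have hI0 := integrableOn_mul_upperWeight N a (Fin.cons 0 ε)
      (continuous_mpderivC (hcons 0 zero_le_one) hg)
    have hI1 := integrableOn_mul_upperWeight N a (Fin.cons 1 ε)
      (continuous_mpderivC (hcons 1 le_rfl) hg)
    have hI (c : ℝ) : IntegrableOn
        (fun y => H (Fin.cons c (mixedPoint N ε y)) * upperWeight (Fin.tail a) ε y)
        (Set.Icc (0 : Fin n → ℝ) (fun _ => (N : ℝ))) := integrableOn_mul_upperWeight N (Fin.tail a) ε
      (hHc.continuous.comp (contDiff_cons_right c (k := 0)).continuous)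
    have hdc : Continuous fun x => fderiv ℝ H x (Pi.single 0 1) :=
      (hHc.continuous_fderiv (by simp)).clm_apply continuous_const
    have hint (y : Fin n → ℝ) :
        ∫ s in Set.Icc (0 : ℝ) N, fderiv ℝ H (Fin.cons s y) (Pi.single 0 1) *
          (if a 0 ≤ s then 1 else 0) = H (Fin.cons (N : ℝ) y) - H (Fin.cons (a 0) y) := by
      refine setIntegral_deriv_mul_indicator
        (h := fun s => H (Fin.cons s y)) (fun s => ?_) ?_ (ha 0) (haN 0)
      · exact ((hHc.differentiable (by simp)) _).hasFDerivAt.comp_hasDerivAt s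
          (hasDerivAt_cons_left s y)
      · refine hdc.comp (continuous_iff_continuousAt.mpr fun s => ?_)
        exact (hasDerivAt_cons_left s y).continuousAt
    have hpart0 : ∫ t in Set.Icc (0 : Fin (n + 1) → ℝ) (fun _ => (N : ℝ)),
        mpderivC (n + 1) (Fin.cons 0 ε) g (mixedPoint N (Fin.cons 0 ε) t) *
          upperWeight a (Fin.cons 0 ε) t =
        N * ∫ y in Set.Icc (0 : Fin n → ℝ) (fun _ => (N : ℝ)),
          H (Fin.cons (N : ℝ) (mixedPoint N ε y)) * upperWeight (Fin.tail a) ε y := by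
      rw [setIntegral_Icc_succ N hI0, ← integral_const_mul]
      simp [mixedPoint_cons, upperWeight_cons, hD0]
    have hpart1 : ∫ t in Set.Icc (0 : Fin (n + 1) → ℝ) (fun _ => (N : ℝ)),
        mpderivC (n + 1) (Fin.cons 1 ε) g (mixedPoint N (Fin.cons 1 ε) t) *
          upperWeight a (Fin.cons 1 ε) t =
        (∫ y in Set.Icc (0 : Fin n → ℝ) (fun _ => (N : ℝ)),
          H (Fin.cons (N : ℝ) (mixedPoint N ε y)) * upperWeight (Fin.tail a) ε y) -
        ∫ y in Set.Icc (0 : Fin n → ℝ) (fun _ => (N : ℝ)),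
          H (Fin.cons (a 0) (mixedPoint N ε y)) * upperWeight (Fin.tail a) ε y := by
      rw [setIntegral_Icc_succ N hI1, ← integral_sub (hI N) (hI (a 0))]
      congr 1
      funext y
      simp only [mixedPoint_cons, upperWeight_cons, hD1, ← mul_assoc]
      rw [integral_mul_const, ← sub_mul, ← hint]
      simp
    rw [hpart0, hpart1, hm]
    simp only [Fin.sum_cons, zero_add, pow_add, pow_succ, pow_zero, one_mul]
    field_simp
    ring

lemma Tsum_mixedPoint {n N : ℕ} (φ : (Fin n → ℤ) → ℂ) {ε : Fin n → ℕ} (hε : ∀ i, ε i ≤ 1)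
    {t : Fin n → ℝ} (ht : t ∈ Set.Icc (0 : Fin n → ℝ) (fun _ => (N : ℝ))) :
    Tsum n φ (mixedPoint N ε t) = ∑ x ∈ Finset.Icc (1 : Fin n → ℤ) (fun _ => (N : ℤ)),
      upperWeight (fun i => (x i : ℝ)) ε t * φ x := by
  have hw : ∀ x : Fin n → ℤ, upperWeight (fun i => (x i : ℝ)) ε t =
      if ∀ i, ε i ≠ 0 → (x i : ℝ) ≤ t i then 1 else 0 := by
    intro x
    rw [upperWeight]
    split_ifs with h
    · refine Finset.prod_eq_one fun i _ => ?_
      split_ifs with h1 h2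
      · rfl
      · rfl
      · exact absurd (h i h1) h2
    · push Not at h
      obtain ⟨i, h1, h2⟩ := h
      exact Finset.prod_eq_zero (Finset.mem_univ i) (by simp [h1, h2.not_ge])
  have hfloor : ∀ i (k : ℤ), k ≤ ⌊mixedPoint N ε t i⌋ ↔
      k ≤ N ∧ (ε i ≠ 0 → (k : ℝ) ≤ t i) := by
    intro i k
    rw [Int.le_floor]
    rcases Nat.le_one_iff_eq_zero_or_eq_one.mp (hε i) with h | h
    · simp only [mixedPoint, h]
      norm_num
      norm_cast
    · simp only [mixedPoint, h]
      norm_num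
      intro hk
      have : (k : ℝ) ≤ N := hk.trans (ht.2 i)
      exact_mod_cast this
  simp only [hw, ite_mul, one_mul, zero_mul]
  rw [Tsum, ← Finset.sum_filter]
  congr 1
  ext x
  simp only [Finset.mem_filter, Finset.mem_Icc, Pi.le_def, hfloor]
  exact ⟨fun h => ⟨⟨h.1, fun i => (h.2 i).1⟩, fun i => (h.2 i).2⟩,
    fun h => ⟨h.1.1, fun i => ⟨h.1.2 i, h.2 i⟩⟩⟩

/-- Partial summation formula. -/
theorem partial_summation (n N : ℕ) (hN : 0 < N)
    (φ : (Fin n → ℤ) → ℂ) (g : (Fin n → ℝ) → ℂ) (hg : ContDiff ℝ (n : ℕ∞) g) :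
    ∑ x ∈ Finset.Icc (1 : Fin n → ℤ) (fun _ => (N : ℤ)), g (fun i => (x i : ℝ)) * φ x =
      ∑ ε ∈ Finset.Icc (0 : Fin n → ℕ) (fun _ => 1),
        ((-(N : ℂ)) ^ (∑ i, ε i) / (N : ℂ) ^ n) *
          ∫ t in Set.Icc (0 : Fin n → ℝ) (fun _ => (N : ℝ)),
            (mpderivC n ε g (fun i => (N : ℝ) * (1 - (ε i : ℝ)) + if ε i = 0 then 0 else t i) *
              Tsum n φ (fun i => (N : ℝ) * (1 - (ε i : ℝ)) + if ε i = 0 then 0 else t i)) := by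
  have hpoint (x : Fin n → ℤ) (hx : x ∈ Finset.Icc (1 : Fin n → ℤ) (fun _ => (N : ℤ))) :=
    eq_sum_integral_mpderivC n N hN g hg (fun i => (x i : ℝ))
      (fun i => by exact_mod_cast zero_le_one.trans ((Finset.mem_Icc.mp hx).1 i))
      (fun i => by exact_mod_cast (Finset.mem_Icc.mp hx).2 i)
  rw [Finset.sum_congr rfl fun x hx => congrArg (· * φ x) (hpoint x hx)]
  simp only [Finset.sum_mul]
  rw [Finset.sum_comm]
  refine Finset.sum_congr rfl fun ε hε => ?_
  have hε1 : ∀ i, ε i ≤ 1 := fun i => (Finset.mem_Icc.mp hε).2 i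
  simp only [mul_assoc, ← Finset.mul_sum, ← integral_mul_const]
  congr 1
  rw [← integral_finsetSum _ fun x _ => by
    simpa only [mul_assoc] using (integrableOn_mul_upperWeight N (fun i => (x i : ℝ)) ε
      (continuous_mpderivC hε1 hg)).mul_const (φ x)]
  refine setIntegral_congr_fun measurableSet_Icc fun t ht => ?_
  change _ = mpderivC n ε g (mixedPoint N ε t) * Tsum n φ (mixedPoint N ε t)
  rw [Tsum_mixedPoint φ hε1 ht, Finset.mul_sum]

end
end

section
/- Given a symmetric n×n real matrix A, let N_A(H, λ) denote the number of h ∈ ℤⁿ satisfying |h| ≤ H and ‖(Ah)_j‖ ≤ λ for all j = 1,…,n. Then for any H ≥ 1, λ ∈ (0, 1/H] and θ ∈ (0, 1], one has N_A(H, λ) ≤ C(n)·(H^{−1} + θ)^{−n}·N_A(θH, θλ) for a constant C(n) depending only on n. -/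
noncomputable section

/-- Distance from a real number to the nearest integer. -/
def nint (x : ℝ) : ℝ := |x - round x|

/-- `N_A(H, λ)`: the number of `h ∈ ℤⁿ` with `|h| ≤ H` and `‖(Ah)_j‖ ≤ λ` for all `j`. -/
def latCount (n : ℕ) (A : Matrix (Fin n) (Fin n) ℝ) (H lam : ℝ) : ℕ :=
  Nat.card {h : Fin n → ℤ //
    (∀ i, |(h i : ℝ)| ≤ H) ∧ ∀ j, nint (A.mulVec (fun i => (h i : ℝ)) j) ≤ lam}

open MeasureTheory Metric Module Function

/-- The `r`-separated finite subsets of the ball of radius `R` have at most `(1 + 2 * R / r) ^ d`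
elements, by comparing volumes. -/
theorem card_mul_pow_le_of_separated {E : Type*} [NormedAddCommGroup E] [NormedSpace ℝ E]
    [FiniteDimensional ℝ E] {r R : ℝ} (hr : 0 < r) (hR : 0 ≤ R) (s : Finset E)
    (hs : ∀ c ∈ s, ‖c‖ ≤ R) (h : ∀ c ∈ s, ∀ d ∈ s, c ≠ d → r ≤ ‖c - d‖) :
    (s.card : ℝ) * (r / 2) ^ finrank ℝ E ≤ (R + r / 2) ^ finrank ℝ E := by
  borelize E
  let μ : Measure E := Measure.addHaar
  have hδ : 0 < r / 2 := by positivity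
  have hρ : 0 < R + r / 2 := by positivity
  have D : Set.Pairwise (s : Set E) (Disjoint on fun c => ball (c : E) (r / 2)) := by
    rintro c hc d hd hcd
    apply ball_disjoint_ball
    rw [dist_eq_norm, add_halves]
    exact h c hc d hd hcd
  have A_subset : (⋃ c ∈ s, ball (c : E) (r / 2)) ⊆ ball (0 : E) (R + r / 2) := by
    refine Set.iUnion₂_subset fun x hx => ball_subset_ball' ?_
    rw [dist_zero_right]
    linarith [hs x hx]
  have I : (s.card : ENNReal) * ENNReal.ofReal ((r / 2) ^ finrank ℝ E) * μ (ball 0 1) ≤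
      ENNReal.ofReal ((R + r / 2) ^ finrank ℝ E) * μ (ball 0 1) :=
    calc
      _ = μ (⋃ c ∈ s, ball (c : E) (r / 2)) := by
        rw [measure_biUnion_finset D fun c _ => measurableSet_ball]
        simp only [μ.addHaar_ball_of_pos _ hδ, Finset.sum_const, nsmul_eq_mul, mul_assoc]
      _ ≤ μ (ball (0 : E) (R + r / 2)) := measure_mono A_subset
      _ = _ := μ.addHaar_ball_of_pos _ hρ
  have J := (ENNReal.mul_le_mul_iff_left
    (measure_ball_pos μ _ zero_lt_one).ne' measure_ball_lt_top.ne).1 I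
  have K := ENNReal.toReal_le_of_le_ofReal (pow_nonneg hρ.le _) J
  rwa [ENNReal.toReal_mul, ENNReal.toReal_natCast, ENNReal.toReal_ofReal (by positivity)] at K

/-- Every finite subset of a metric space has a maximal `r`-separated subset, which is then
an `r`-net. -/
theorem exists_separated_net {E : Type*} [SeminormedAddCommGroup E] (r : ℝ) (hr : 0 ≤ r)
    (s : Finset E) :
    ∃ t ⊆ s, (∀ c ∈ t, ∀ d ∈ t, c ≠ d → r ≤ ‖c - d‖) ∧ ∀ x ∈ s, ∃ c ∈ t, ‖x - c‖ ≤ r := by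
  classical
  obtain ⟨t, ht⟩ := (s.powerset.filter
    fun t => ∀ c ∈ t, ∀ d ∈ t, c ≠ d → r ≤ ‖c - d‖).exists_maximal ⟨∅, by simp⟩
  have hts := ht.prop
  simp only [Finset.mem_filter, Finset.mem_powerset] at hts
  refine ⟨t, hts.1, hts.2, fun x hx => ?_⟩
  by_contra! hfar
  have hxt : x ∉ t := fun hxt => by
    have := hfar x hxt
    simp only [sub_self, norm_zero] at this
    linarith
  refine hxt (ht.le_of_ge (y := insert x t) ?_ (Finset.subset_insert x t)
    (Finset.mem_insert_self x t))
  simp only [Finset.mem_filter, Finset.mem_powerset]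
  refine ⟨Finset.insert_subset hx hts.1, fun c hc d hd hcd => ?_⟩
  rcases Finset.mem_insert.1 hc with rfl | hc <;> rcases Finset.mem_insert.1 hd with hd | hd
  · exact absurd hd.symm hcd
  · exact (hfar d hd).le
  · rw [hd, norm_sub_rev]; exact (hfar c hc).le
  · exact hts.2 c hc d hd hcd

/-- Shrinking the radius of a ball by a factor decreases the number of points of a subgroup
by at most a constant times the `d`-th power of this factor. -/
theorem ncard_inter_closedBall_le {E : Type*} [NormedAddCommGroup E] [NormedSpace ℝ E]
    [FiniteDimensional ℝ E] (G : AddSubgroup E) {r R : ℝ} (hr : 0 < r) (hrR : r ≤ R)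
    (hfin : ((G : Set E) ∩ closedBall 0 R).Finite) :
    (((G : Set E) ∩ closedBall 0 R).ncard : ℝ) ≤
      (3 * R / r) ^ finrank ℝ E * (((G : Set E) ∩ closedBall 0 r).ncard : ℝ) := by
  classical
  have hfin' : ((G : Set E) ∩ closedBall 0 r).Finite :=
    hfin.subset (Set.inter_subset_inter_right _ (closedBall_subset_closedBall hrR))
  have hmem : ∀ {x : E} {ρ : ℝ}, x ∈ (G : Set E) ∩ closedBall 0 ρ ↔ x ∈ G ∧ ‖x‖ ≤ ρ := by
    intro x ρ
    simp
  rw [Set.ncard_eq_toFinset_card _ hfin, Set.ncard_eq_toFinset_card _ hfin']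
  obtain ⟨t, hts, hsep, hnet⟩ := exists_separated_net r hr.le hfin.toFinset
  choose! f hft hf using hnet
  have hcard : hfin.toFinset.card ≤ hfin'.toFinset.card * t.card := by
    refine Finset.card_le_mul_card_image_of_maps_to hft _ fun b hb => ?_
    refine Finset.card_le_card_of_injOn (fun x => x - b) (fun x hx => ?_)
      (fun x _ y _ hxy => sub_left_injective hxy)
    obtain ⟨hxs, rfl⟩ := Finset.mem_filter.1 hx
    have hb' := hmem.1 (hfin.mem_toFinset.1 (hts hb))
    have hx' := hmem.1 (hfin.mem_toFinset.1 hxs)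
    exact hfin'.mem_toFinset.2 (hmem.2 ⟨G.sub_mem hx'.1 hb'.1, hf x hxs⟩)
  have ht := card_mul_pow_le_of_separated hr (hr.le.trans hrR) t
    (fun c hc => (hmem.1 (hfin.mem_toFinset.1 (hts hc))).2) hsep
  have ht' : (t.card : ℝ) ≤ (3 * R / r) ^ finrank ℝ E := by
    calc (t.card : ℝ) ≤ (R + r / 2) ^ finrank ℝ E / (r / 2) ^ finrank ℝ E := by
          rwa [le_div_iff₀ (by positivity)]
      _ = ((R + r / 2) / (r / 2)) ^ finrank ℝ E := (div_pow _ _ _).symm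
      _ ≤ _ := by
          refine pow_le_pow_left₀ (by have := hr.trans_le hrR; positivity) ?_ _
          rw [div_le_div_iff₀ (by positivity) hr]
          nlinarith
  calc (hfin.toFinset.card : ℝ) ≤ hfin'.toFinset.card * t.card := mod_cast hcard
    _ ≤ _ := by rw [mul_comm]; gcongr

/-- The same with the exponent replaced by the dimension of any subspace containing the points of
the larger ball. -/
theorem ncard_inter_closedBall_le_of_subset {E : Type*} [NormedAddCommGroup E] [NormedSpace ℝ E]
    [FiniteDimensional ℝ E] (G : AddSubgroup E) (V : Submodule ℝ E) {r R : ℝ} (hr : 0 < r)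
    (hrR : r ≤ R) (hfin : ((G : Set E) ∩ closedBall 0 R).Finite)
    (hV : (G : Set E) ∩ closedBall 0 R ⊆ V) :
    (((G : Set E) ∩ closedBall 0 R).ncard : ℝ) ≤
      (3 * R / r) ^ finrank ℝ V * (((G : Set E) ∩ closedBall 0 r).ncard : ℝ) := by
  let G' : AddSubgroup V := G.comap V.subtype.toAddMonoidHom
  have himage : ∀ ρ ≤ R, Subtype.val '' ((G' : Set V) ∩ closedBall 0 ρ) =
      (G : Set E) ∩ closedBall 0 ρ := by
    intro ρ hρ
    ext x
    constructor
    · rintro ⟨y, ⟨hy, hy'⟩, rfl⟩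
      exact ⟨hy, by simpa using hy'⟩
    · rintro ⟨hx, hx'⟩
      exact ⟨⟨x, hV ⟨hx, closedBall_subset_closedBall hρ hx'⟩⟩, ⟨hx, by simpa using hx'⟩, rfl⟩
  have hcard : ∀ ρ ≤ R, ((G' : Set V) ∩ closedBall 0 ρ).ncard =
      ((G : Set E) ∩ closedBall 0 ρ).ncard := fun ρ hρ => by
    rw [← himage ρ hρ, Set.ncard_image_of_injective _ Subtype.val_injective]
  rw [← hcard R le_rfl, ← hcard r hrR]
  refine ncard_inter_closedBall_le G' hr hrR ?_
  rw [← himage R le_rfl] at hfin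
  exact hfin.of_finite_image Subtype.val_injective.injOn

/-- The standard symplectic form on `ℝⁿ × ℝⁿ`. -/
def stdSymplectic (n : ℕ) : LinearMap.BilinForm ℝ ((Fin n → ℝ) × (Fin n → ℝ)) :=
  LinearMap.mk₂ ℝ (fun u v => u.1 ⬝ᵥ v.2 - v.1 ⬝ᵥ u.2)
    (fun u u' v => by simp only [Prod.fst_add, Prod.snd_add, add_dotProduct, dotProduct_add]; ring)
    (fun c u v => by
      simp only [Prod.smul_fst, Prod.smul_snd, smul_dotProduct, dotProduct_smul, smul_eq_mul]; ring)
    (fun u v v' => by simp only [Prod.fst_add, Prod.snd_add, add_dotProduct, dotProduct_add]; ring)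
    (fun c u v => by
      simp only [Prod.smul_fst, Prod.smul_snd, smul_dotProduct, dotProduct_smul, smul_eq_mul]; ring)

theorem stdSymplectic_apply {n : ℕ} (u v : (Fin n → ℝ) × (Fin n → ℝ)) :
    stdSymplectic n u v = u.1 ⬝ᵥ v.2 - v.1 ⬝ᵥ u.2 := rfl

theorem stdSymplectic_nondegenerate (n : ℕ) : (stdSymplectic n).Nondegenerate := by
  constructor
  · intro u hu
    have h1 : u.1 = 0 := dotProduct_eq_zero _ fun w => by
      simpa [stdSymplectic_apply] using hu (0, w)
    have h2 : u.2 = 0 := dotProduct_eq_zero _ fun w => by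
      simpa [stdSymplectic_apply, dotProduct_comm] using hu (w, 0)
    exact Prod.ext h1 h2
  · intro u hu
    have h1 : u.1 = 0 := dotProduct_eq_zero _ fun w => by
      simpa [stdSymplectic_apply] using hu (0, w)
    have h2 : u.2 = 0 := dotProduct_eq_zero _ fun w => by
      simpa [stdSymplectic_apply, dotProduct_comm] using hu (w, 0)
    exact Prod.ext h1 h2

/-- The span of pairwise orthogonal vectors for the standard symplectic form has dimension
at most `n`. -/
theorem finrank_span_le_of_isotropic {n : ℕ} (S : Set ((Fin n → ℝ) × (Fin n → ℝ)))
    (hS : ∀ u ∈ S, ∀ v ∈ S, stdSymplectic n u v = 0) :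
    finrank ℝ (Submodule.span ℝ S) ≤ n := by
  set V := Submodule.span ℝ S
  have hle : V ≤ (stdSymplectic n).orthogonal V := by
    intro v hv u hu
    change stdSymplectic n u v = 0
    induction hu, hv using Submodule.span_induction₂ with
    | mem_mem u v hu hv => exact hS u hu v hv
    | zero_left v _ => simp
    | zero_right u _ => simp
    | add_left u u' v _ _ _ h h' => simp [h, h']
    | add_right u v v' _ _ _ h h' => simp [h, h']
    | smul_left c u v _ _ h => simp [h]
    | smul_right c u v _ _ h => simp [h]
  have h1 := Submodule.finrank_mono hle
  rw [LinearMap.BilinForm.finrank_orthogonal (stdSymplectic_nondegenerate n)] at h1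
  have h2 : finrank ℝ ((Fin n → ℝ) × (Fin n → ℝ)) = n + n := by simp
  omega

/-- The embedding `(h, m) ↦ (h / H, (A h - m) / λ)` of `ℤⁿ × ℤⁿ` as a lattice in `ℝⁿ × ℝⁿ`. -/
def latticeHom {n : ℕ} (A : Matrix (Fin n) (Fin n) ℝ) (H lam : ℝ) :
    (Fin n → ℤ) × (Fin n → ℤ) →+ (Fin n → ℝ) × (Fin n → ℝ) :=
  AddMonoidHom.mk' (fun p =>
    (fun i => (p.1 i : ℝ) / H,
      fun j => (A.mulVec (fun i => (p.1 i : ℝ)) j - (p.2 j : ℝ)) / lam)) (by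
    intro p q
    ext i
    · simp [add_div]
    · have : (fun i => ((p.1 i : ℝ) + (q.1 i : ℝ))) =
        (fun i => (p.1 i : ℝ)) + fun i => (q.1 i : ℝ) := rfl
      simp only [Prod.fst_add, Prod.snd_add, Pi.add_apply, Int.cast_add, this, Matrix.mulVec_add]
      ring)

section Lattice

variable {n : ℕ} {A : Matrix (Fin n) (Fin n) ℝ} {H lam : ℝ}

theorem latticeHom_apply (p : (Fin n → ℤ) × (Fin n → ℤ)) :
    latticeHom A H lam p = (fun i => (p.1 i : ℝ) / H,
      fun j => (A.mulVec (fun i => (p.1 i : ℝ)) j - (p.2 j : ℝ)) / lam) := rfl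

theorem norm_latticeHom_le_iff (hH : 0 < H) (hl : 0 < lam) {R : ℝ} (hR : 0 ≤ R)
    (p : (Fin n → ℤ) × (Fin n → ℤ)) :
    ‖latticeHom A H lam p‖ ≤ R ↔ (∀ i, |(p.1 i : ℝ)| ≤ R * H) ∧
      ∀ j, |A.mulVec (fun i => (p.1 i : ℝ)) j - (p.2 j : ℝ)| ≤ R * lam := by
  rw [latticeHom_apply, Prod.norm_def, max_le_iff, pi_norm_le_iff_of_nonneg hR,
    pi_norm_le_iff_of_nonneg hR]
  simp only [Real.norm_eq_abs, abs_div, abs_of_pos hH, abs_of_pos hl, div_le_iff₀ hH,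
    div_le_iff₀ hl]

theorem latticeHom_injective (hH : 0 < H) (hl : 0 < lam) :
    Injective (latticeHom A H lam) := by
  intro p q hpq
  simp only [latticeHom_apply, Prod.mk.injEq, funext_iff] at hpq
  have h1 : p.1 = q.1 := by
    ext i
    have := (div_left_inj' hH.ne').1 (hpq.1 i)
    exact_mod_cast this
  refine Prod.ext h1 (funext fun j => ?_)
  have := (div_left_inj' hl.ne').1 (hpq.2 j)
  rw [h1] at this
  exact_mod_cast sub_right_injective this

theorem finite_setOf_norm_latticeHom_le (hH : 0 < H) (hl : 0 < lam) {R : ℝ} (hR : 0 ≤ R) :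
    {p | ‖latticeHom A H lam p‖ ≤ R}.Finite := by
  refine ((Set.finite_Icc (fun _ : Fin n => -⌊R * H⌋) (fun _ => ⌊R * H⌋)).biUnion
    fun h _ => (Set.finite_singleton h).prod (Set.finite_Icc
      (fun j => ⌈A.mulVec (fun i => (h i : ℝ)) j - R * lam⌉)
      (fun j => ⌊A.mulVec (fun i => (h i : ℝ)) j + R * lam⌋))).subset ?_
  rintro ⟨h, m⟩ hp
  obtain ⟨h1, h2⟩ := (norm_latticeHom_le_iff hH hl hR _).1 hp
  simp only [Set.mem_iUnion]
  refine ⟨h, ⟨fun i => ?_, fun i => ?_⟩, rfl, fun j => ?_, fun j => ?_⟩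
  · have := (abs_le.1 (h1 i)).1
    have h3 : -h i ≤ ⌊R * H⌋ := Int.le_floor.2 (by push_cast; linarith)
    simp only
    linarith
  · exact Int.le_floor.2 (abs_le.1 (h1 i)).2
  · have := (abs_le.1 (h2 j)).2
    exact Int.ceil_le.2 (by simp only at this ⊢; linarith)
  · have := (abs_le.1 (h2 j)).1
    exact Int.le_floor.2 (by simp only at this ⊢; linarith)

theorem range_latticeHom_inter_closedBall (R : ℝ) :
    ((latticeHom A H lam).range : Set ((Fin n → ℝ) × (Fin n → ℝ))) ∩ closedBall 0 R =
      latticeHom A H lam '' {p | ‖latticeHom A H lam p‖ ≤ R} := by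
  ext x
  constructor
  · rintro ⟨⟨p, rfl⟩, hp⟩
    exact ⟨p, by simpa using hp, rfl⟩
  · rintro ⟨p, hp, rfl⟩
    exact ⟨⟨p, rfl⟩, by simpa using hp⟩

theorem mul_stdSymplectic_latticeHom (hA : A.IsSymm) (hH : 0 < H) (hl : 0 < lam)
    (p q : (Fin n → ℤ) × (Fin n → ℤ)) :
    H * lam * stdSymplectic n (latticeHom A H lam p) (latticeHom A H lam q) =
      ((q.1 ⬝ᵥ p.2 - p.1 ⬝ᵥ q.2 : ℤ) : ℝ) := by
  have hsymm : (fun i => (p.1 i : ℝ)) ⬝ᵥ A.mulVec (fun i => (q.1 i : ℝ)) =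
      (fun i => (q.1 i : ℝ)) ⬝ᵥ A.mulVec (fun i => (p.1 i : ℝ)) := by
    rw [Matrix.dotProduct_mulVec, dotProduct_comm, ← Matrix.mulVec_transpose, hA.eq]
  have key : ∀ p q : (Fin n → ℤ) × (Fin n → ℤ),
      H * lam * ((latticeHom A H lam p).1 ⬝ᵥ (latticeHom A H lam q).2) =
      (fun i => (p.1 i : ℝ)) ⬝ᵥ A.mulVec (fun i => (q.1 i : ℝ)) - ((p.1 ⬝ᵥ q.2 : ℤ) : ℝ) := by
    intro p q
    simp only [dotProduct, latticeHom_apply, Finset.mul_sum, Int.cast_sum, Int.cast_mul,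
      ← Finset.sum_sub_distrib]
    refine Finset.sum_congr rfl fun i _ => ?_
    field_simp
  rw [stdSymplectic_apply, mul_sub, key, key, hsymm]
  push_cast
  ring

theorem abs_dotProduct_le {u v : Fin n → ℝ} {r : ℝ} (hr : 0 ≤ r) (hu : ‖u‖ ≤ r) (hv : ‖v‖ ≤ r) :
    |u ⬝ᵥ v| ≤ n * r ^ 2 := by
  calc |u ⬝ᵥ v| ≤ ∑ i, |u i * v i| := Finset.abs_sum_le_sum_abs _ _
    _ ≤ ∑ _i : Fin n, r ^ 2 := by
        refine Finset.sum_le_sum fun i _ => ?_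
        rw [abs_mul, sq]
        exact mul_le_mul ((norm_le_pi_norm u i).trans hu) ((norm_le_pi_norm v i).trans hv)
          (abs_nonneg _) hr
    _ = n * r ^ 2 := by simp

/-- Short lattice vectors are pairwise orthogonal for the standard symplectic form. -/
theorem stdSymplectic_latticeHom_eq_zero (hA : A.IsSymm) (hH : 0 < H) (hl : 0 < lam)
    (hHl : H * lam ≤ 1) {r : ℝ} (hr : 0 ≤ r) (hnr : 2 * n * r ^ 2 < 1)
    {p q : (Fin n → ℤ) × (Fin n → ℤ)} (hp : ‖latticeHom A H lam p‖ ≤ r)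
    (hq : ‖latticeHom A H lam q‖ ≤ r) :
    stdSymplectic n (latticeHom A H lam p) (latticeHom A H lam q) = 0 := by
  have key := mul_stdSymplectic_latticeHom hA hH hl p q
  have h1 := abs_dotProduct_le hr ((norm_fst_le _).trans hp) ((norm_snd_le _).trans hq)
  have h2 := abs_dotProduct_le hr ((norm_fst_le _).trans hq) ((norm_snd_le _).trans hp)
  have hlt : |stdSymplectic n (latticeHom A H lam p) (latticeHom A H lam q)| < 1 := by
    rw [stdSymplectic_apply]
    linarith [abs_sub ((latticeHom A H lam p).1 ⬝ᵥ (latticeHom A H lam q).2)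
      ((latticeHom A H lam q).1 ⬝ᵥ (latticeHom A H lam p).2)]
  have hint : |q.1 ⬝ᵥ p.2 - p.1 ⬝ᵥ q.2| < 1 := by
    have : |((q.1 ⬝ᵥ p.2 - p.1 ⬝ᵥ q.2 : ℤ) : ℝ)| < 1 := by
      rw [← key, abs_mul, abs_of_pos (mul_pos hH hl)]
      exact (mul_le_of_le_one_left (abs_nonneg _) hHl).trans_lt hlt
    exact_mod_cast this
  rw [Int.abs_lt_one_iff.1 hint, Int.cast_zero] at key
  exact (mul_eq_zero.1 key).resolve_left (mul_pos hH hl).ne'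

theorem ncard_range_latticeHom_inter (hH : 0 < H) (hl : 0 < lam) (R : ℝ) :
    (((latticeHom A H lam).range : Set ((Fin n → ℝ) × (Fin n → ℝ))) ∩ closedBall 0 R).ncard =
      {p | ‖latticeHom A H lam p‖ ≤ R}.ncard := by
  rw [range_latticeHom_inter_closedBall, Set.ncard_image_of_injective _
    (latticeHom_injective hH hl)]

/-- The number of lattice points in the unit ball, compared with that in a smaller ball. -/
theorem ncard_latticeHom_le (hA : A.IsSymm) (hH : 0 < H) (hl : 0 < lam) (hHl : H * lam ≤ 1)
    {r t : ℝ} (hr : 0 < r) (hr1 : r ≤ 1) (hnr : 2 * n * r ^ 2 < 1) (ht : 0 < t) (ht1 : t ≤ 1) :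
    ({p | ‖latticeHom A H lam p‖ ≤ 1}.ncard : ℝ) ≤
      (3 / r) ^ (n + n) * (3 / t) ^ n * {p | ‖latticeHom A H lam p‖ ≤ t * r}.ncard := by
  have hfin : ∀ R, 0 ≤ R →
      (((latticeHom A H lam).range : Set ((Fin n → ℝ) × (Fin n → ℝ))) ∩ closedBall 0 R).Finite := by
    intro R hR
    rw [range_latticeHom_inter_closedBall]
    exact (finite_setOf_norm_latticeHom_le hH hl hR).image _
  have h1 := ncard_inter_closedBall_le (latticeHom A H lam).range hr hr1 (hfin 1 zero_le_one)
  have h2 := ncard_inter_closedBall_le_of_subset (latticeHom A H lam).range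
    (Submodule.span ℝ
      (((latticeHom A H lam).range : Set ((Fin n → ℝ) × (Fin n → ℝ))) ∩ closedBall 0 r))
    (mul_pos ht hr) (mul_le_of_le_one_left hr.le ht1) (hfin r hr.le) Submodule.subset_span
  have hrank := finrank_span_le_of_isotropic
    (((latticeHom A H lam).range : Set ((Fin n → ℝ) × (Fin n → ℝ))) ∩ closedBall 0 r) (by
      rw [range_latticeHom_inter_closedBall]
      rintro _ ⟨p, hp, rfl⟩ _ ⟨q, hq, rfl⟩
      exact stdSymplectic_latticeHom_eq_zero hA hH hl hHl hr.le hnr hp hq)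
  have hfr : finrank ℝ ((Fin n → ℝ) × (Fin n → ℝ)) = n + n := by simp
  have h3t : 3 * r / (t * r) = 3 / t := by field_simp
  have h3t1 : 1 ≤ 3 / t := by rw [le_div_iff₀ ht]; linarith
  rw [hfr, mul_one] at h1
  rw [h3t] at h2
  rw [ncard_range_latticeHom_inter hH hl, ncard_range_latticeHom_inter hH hl] at h1 h2
  rw [mul_assoc]
  refine h1.trans (mul_le_mul_of_nonneg_left (h2.trans ?_) (by positivity))
  exact mul_le_mul_of_nonneg_right (pow_le_pow_right₀ h3t1 hrank) (Nat.cast_nonneg _)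

theorem finite_setOf_latCount (H lam : ℝ) :
    {h : Fin n → ℤ | (∀ i, |(h i : ℝ)| ≤ H) ∧
      ∀ j, nint (A.mulVec (fun i => (h i : ℝ)) j) ≤ lam}.Finite := by
  refine (Set.finite_Icc (fun _ : Fin n => -⌊H⌋) (fun _ => ⌊H⌋)).subset ?_
  rintro h ⟨h1, -⟩
  refine ⟨fun i => ?_, fun i => Int.le_floor.2 (abs_le.1 (h1 i)).2⟩
  have := (abs_le.1 (h1 i)).1
  have h3 : -h i ≤ ⌊H⌋ := Int.le_floor.2 (by push_cast; linarith)
  simp only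
  linarith

theorem latCount_le_ncard (hH : 0 < H) (hl : 0 < lam) :
    latCount n A H lam ≤ {p | ‖latticeHom A H lam p‖ ≤ 1}.ncard := by
  refine Set.ncard_le_ncard_of_injOn
    (s := {h : Fin n → ℤ | (∀ i, |(h i : ℝ)| ≤ H) ∧
      ∀ j, nint (A.mulVec (fun i => (h i : ℝ)) j) ≤ lam})
    (fun h => (h, fun j => round (A.mulVec (fun i => (h i : ℝ)) j)))
    (fun h hh => ?_) (fun h _ h' _ e => (Prod.ext_iff.1 e).1)
    (finite_setOf_norm_latticeHom_le hH hl zero_le_one)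
  refine (norm_latticeHom_le_iff hH hl zero_le_one _).2 ?_
  simp only [one_mul]
  exact hh

/-- Lattice points in a small ball are determined by their first component, which is counted by
`latCount`. -/
theorem ncard_le_latCount (hH : 1 ≤ H) (hl : 0 < lam) (hHl : H * lam ≤ 1) {r θ : ℝ}
    (hr : 0 < r) (hr1 : 2 * r < 1) (hθ : 0 < θ) (hθ1 : θ ≤ 1) :
    {p | ‖latticeHom A H lam p‖ ≤ max θ H⁻¹ * r}.ncard ≤ latCount n A (θ * H) (θ * lam) := by
  have hH0 : 0 < H := by linarith
  have hl1 : lam ≤ 1 := by nlinarith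
  have hmax : 0 < max θ H⁻¹ := lt_max_of_lt_left hθ
  have hmax1 : max θ H⁻¹ ≤ 1 := max_le hθ1 (inv_le_one_of_one_le₀ hH)
  have hR : 0 ≤ max θ H⁻¹ * r := by positivity
  refine Set.ncard_le_ncard_of_injOn
    (t := {h : Fin n → ℤ | (∀ i, |(h i : ℝ)| ≤ θ * H) ∧
      ∀ j, nint (A.mulVec (fun i => (h i : ℝ)) j) ≤ θ * lam})
    Prod.fst (fun p hp => ?_) (fun p hp q hq e => ?_) (finite_setOf_latCount _ _)
  · obtain ⟨h1, h2⟩ := (norm_latticeHom_le_iff hH0 hl hR p).1 hp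
    rcases le_total H⁻¹ θ with hle | hle
    · rw [max_eq_left hle] at h1 h2
      have hθr : θ * r ≤ θ := mul_le_of_le_one_right hθ.le (by linarith)
      exact ⟨fun i => (h1 i).trans (by gcongr), fun j =>
        (round_le _ _).trans ((h2 j).trans (by gcongr))⟩
    · rw [max_eq_right hle] at h1
      have h0 : p.1 = 0 := by
        funext i
        have h3 : |(p.1 i : ℝ)| < 1 := (h1 i).trans_lt (by
          rw [mul_right_comm, inv_mul_cancel₀ hH0.ne']
          linarith)
        exact Int.abs_lt_one_iff.1 (by exact_mod_cast h3)
      have hzero : (fun i => ((0 : Fin n → ℤ) i : ℝ)) = 0 := by ext; simp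
      refine ⟨fun i => ?_, fun j => ?_⟩
      · rw [h0]
        simp only [Pi.zero_apply, Int.cast_zero, abs_zero]
        positivity
      · rw [h0, hzero, Matrix.mulVec_zero]
        simp only [nint, Pi.zero_apply, round_zero, Int.cast_zero, sub_zero, abs_zero]
        positivity
  · refine Prod.ext e (funext fun j => ?_)
    have hp2 := ((norm_latticeHom_le_iff hH0 hl hR p).1 hp).2 j
    have hq2 := ((norm_latticeHom_le_iff hH0 hl hR q).1 hq).2 j
    rw [e] at hp2
    have hsmall : max θ H⁻¹ * r * lam ≤ r := by
      have : max θ H⁻¹ * r ≤ r := mul_le_of_le_one_left hr.le hmax1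
      nlinarith
    have h3 : |((p.2 j : ℝ) - (q.2 j : ℝ))| < 1 := by
      rw [abs_le] at hp2 hq2
      rw [abs_lt]
      constructor <;> linarith [hp2.1, hp2.2, hq2.1, hq2.2]
    have h4 : |p.2 j - q.2 j| < 1 := by exact_mod_cast h3
    exact sub_eq_zero.1 (Int.abs_lt_one_iff.1 h4)

end Lattice

/-- The shrinking lemma. -/
theorem shrinking_lemma (n : ℕ) :
    ∃ C : ℝ, 0 < C ∧
      ∀ (A : Matrix (Fin n) (Fin n) ℝ), A.IsSymm →
        ∀ H lam θ : ℝ, 1 ≤ H → 0 < lam → lam ≤ 1 / H → 0 < θ → θ ≤ 1 →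
          (latCount n A H lam : ℝ) ≤
            C * ((H⁻¹ + θ)⁻¹) ^ n * (latCount n A (θ * H) (θ * lam) : ℝ) := by
  set r : ℝ := (2 * n + 3)⁻¹ with hr_def
  have hn : (0 : ℝ) ≤ n := Nat.cast_nonneg n
  have hr : 0 < r := by positivity
  have hrn : r * (2 * n + 3) = 1 := inv_mul_cancel₀ (by positivity)
  have hr3 : 3 * r ≤ 1 := by nlinarith [mul_nonneg hr.le hn]
  refine ⟨(3 / r) ^ (n + n) * 6 ^ n, by positivity, ?_⟩
  intro A hA H lam θ hH hl hlH hθ hθ1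
  have hH0 : 0 < H := by linarith
  have hHl : H * lam ≤ 1 := by rwa [le_div_iff₀ hH0, mul_comm] at hlH
  have ht : 0 < max θ H⁻¹ := lt_max_of_lt_left hθ
  have hcoef : 3 / max θ H⁻¹ ≤ 6 * (H⁻¹ + θ)⁻¹ := by
    rw [← div_eq_mul_inv, div_le_div_iff₀ ht (by positivity)]
    linarith [le_max_left θ H⁻¹, le_max_right θ H⁻¹]
  calc (latCount n A H lam : ℝ) ≤ {p | ‖latticeHom A H lam p‖ ≤ 1}.ncard :=
        mod_cast latCount_le_ncard hH0 hl
    _ ≤ (3 / r) ^ (n + n) * (3 / max θ H⁻¹) ^ n *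
          {p | ‖latticeHom A H lam p‖ ≤ max θ H⁻¹ * r}.ncard :=
        ncard_latticeHom_le hA hH0 hl hHl hr (by linarith)
          (by nlinarith [mul_nonneg hr.le hn]) ht
          (max_le hθ1 (inv_le_one_of_one_le₀ hH))
    _ ≤ (3 / r) ^ (n + n) * (6 * (H⁻¹ + θ)⁻¹) ^ n * latCount n A (θ * H) (θ * lam) := by
        gcongr
        exact ncard_le_latCount hH hl hHl hr (by linarith) hθ hθ1
    _ = _ := by rw [mul_pow]; ring

end
end

section
/- Let α ∈ ℝ/ℤ and q ∈ ℕ be primitive. Suppose that m ∈ ℤ satisfies: (i) |m| < (1/2)·‖qα‖^{−1}; (ii) ‖mα‖ < (1/2)·q^{−1}; and (iii) |m| < q or ‖mα‖ < ‖qα‖. Then m = 0. -/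
noncomputable section

/-- `α ∈ 𝕋` and `q ∈ ℕ` are *primitive* if there is `a ∈ ℤ` coprime to `q`
with `‖qα‖ = |qα - a|`. -/
def Primitive (α : ℝ) (q : ℕ) : Prop :=
  ∃ a : ℤ, Int.gcd a q = 1 ∧ nint (q * α) = |q * α - a|

/-- Heath-Brown's diophantine approximation lemma.  Condition (i), `|m| < ½‖qα‖⁻¹`,
is stated in the equivalent multiplied-out form `|m|·‖qα‖ < ½` (so that it is
vacuous when `‖qα‖ = 0`). -/
theorem heath_brown_lemma (α : ℝ) (q : ℕ) (hq : 0 < q) (hprim : Primitive α q) (m : ℤ)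
    (h1 : (|m| : ℝ) * nint (q * α) < 1 / 2)
    (h2 : nint (m * α) < 1 / 2 * (q : ℝ)⁻¹)
    (h3 : (|m| : ℝ) < q ∨ nint (m * α) < nint (q * α)) :
    m = 0 := by
  obtain ⟨a, hcop, ha⟩ := hprim
  have hq' : (0 : ℝ) < q := by exact_mod_cast hq
  rw [ha] at h1 h3
  unfold nint at h2 h3
  set b : ℤ := round ((m : ℝ) * α)
  have h2' : (q : ℝ) * |m * α - b| < 1 / 2 := by
    calc (q : ℝ) * |m * α - b| < q * (1 / 2 * (q : ℝ)⁻¹) := by gcongr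
      _ = 1 / 2 := by field_simp
  have key : (q : ℤ) * b - m * a = 0 := by
    rw [← Int.abs_lt_one_iff]
    have h : |((q : ℝ) * b - m * a)| < 1 := by
      calc |((q : ℝ) * b - m * a)| = |m * (q * α - a) - q * (m * α - b)| := by ring_nf
        _ ≤ |m * (q * α - a)| + |q * (m * α - b)| := abs_sub _ _
        _ = |(m : ℝ)| * |q * α - a| + q * |m * α - b| := by
          rw [abs_mul, abs_mul, abs_of_pos hq']
        _ < 1 := by linarith
    exact_mod_cast h
  have hdvd : (q : ℤ) ∣ m :=
    Int.dvd_of_dvd_mul_left_of_gcd_one ⟨b, by linarith⟩ (by rwa [Int.gcd_comm])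
  rcases h3 with h3 | h3
  · exact Int.eq_zero_of_abs_lt_dvd hdvd (by exact_mod_cast h3)
  · obtain ⟨k, rfl⟩ := hdvd
    have hb : b = k * a := by
      have hq0 : (q : ℤ) ≠ 0 := by positivity
      exact mul_left_cancel₀ hq0 (by linarith)
    have hk : |((q * k : ℤ) : ℝ) * α - b| = |(k : ℝ)| * |q * α - a| := by
      rw [hb, ← abs_mul]
      push_cast
      ring_nf
    rw [hk] at h3
    have hk1 : |(k : ℝ)| < 1 := by
      by_contra! h
      exact absurd h3 (not_lt.2 (le_mul_of_one_le_left (abs_nonneg _) h))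
    have hk0 : k = 0 := Int.abs_lt_one_iff.1 (by exact_mod_cast hk1)
    rw [hk0, mul_zero]

end
end
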